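/- Under the hypotheses of the previous adaptive-sampling bound (columns of the rank-n matrix F lie in the span of the orthonormal Ubar; C = (PᵀU)^{-1}PᵀF with PᵀU invertible and PᵀF of rank n; R = UC − F; component-wise residuals satisfy ‖Rᵀe_{j(i)}‖₂² ≤ c_1·exp(−c_2·i^a) with c_1, c_2 > 0, a > 1; S selects the m indices j(1),…,j(m); ΔU satisfies SbreveᵀΔU = 0 and Sᵀ(((U+ΔU)C − F)) = 0; U + ΔU has rank n with orthonormal basis Uhat), set c_3 = c_1 / ((1 − exp(−c_2))·σ_min(F)²). Then for every ε > 0, if the number of sampling points satisfies m ≥ min{ N, (−(1/c_2)·log(ε/c_3))^{1/a} }, it holds that ‖Ubar − Uhat Uhatᵀ Ubar‖_F² ≤ ε. -/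

import Mathlib

open Matrix Finset

/-- Squared Frobenius norm of a real matrix. -/
noncomputable def frobSq {m k : ℕ} (A : Matrix (Fin m) (Fin k) ℝ) : ℝ :=
  ∑ i, ∑ j, A i j ^ 2

/-- Squared Euclidean norm of the `i`-th row of `A`, i.e. `‖Aᵀ e_i‖₂²`. -/
noncomputable def rowNormSq {m k : ℕ} (A : Matrix (Fin m) (Fin k) ℝ) (i : Fin m) : ℝ :=
  ∑ j, A i j ^ 2

/-- The matrix `[e_{s 0}, …, e_{s (m-1)}] ∈ ℝ^{N×m}` whose columns are the canonical
unit vectors of `ℝ^N` selected by `s`. -/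
noncomputable def samplingMatrix {N m : ℕ} (s : Fin m → Fin N) : Matrix (Fin N) (Fin m) ℝ :=
  Matrix.of fun i k => if i = s k then 1 else 0

/-- `σ : Fin r → ℝ` is the (decreasingly sorted) list of nonzero singular values of `M`. -/
def IsSingularValues {m k : ℕ} (M : Matrix (Fin m) (Fin k) ℝ) (r : ℕ) (σ : Fin r → ℝ) : Prop :=
  (∀ i, 0 < σ i) ∧ Antitone σ ∧
  ∃ (u : Fin r → Fin m → ℝ) (v : Fin r → Fin k → ℝ),
    (∀ i j, u i ⬝ᵥ u j = if i = j then (1 : ℝ) else 0) ∧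
    (∀ i j, v i ⬝ᵥ v j = if i = j then (1 : ℝ) else 0) ∧
    M = ∑ i, σ i • Matrix.vecMulVec (u i) (v i)

lemma frobSq_nonneg {m k : ℕ} (A : Matrix (Fin m) (Fin k) ℝ) : 0 ≤ frobSq A :=
  Finset.sum_nonneg fun _ _ => Finset.sum_nonneg fun _ _ => sq_nonneg _

lemma frobSq_eq_trace_mul_transpose {m k : ℕ} (A : Matrix (Fin m) (Fin k) ℝ) :
    frobSq A = (A * Aᵀ).trace := by
  simp [frobSq, Matrix.trace, Matrix.mul_apply, sq]

lemma frobSq_eq_trace_transpose_mul {m k : ℕ} (A : Matrix (Fin m) (Fin k) ℝ) :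
    frobSq A = (Aᵀ * A).trace := by
  rw [frobSq_eq_trace_mul_transpose, Matrix.trace_mul_comm]

/-- The Frobenius norm is invariant under right multiplication by orthonormal rows. -/
lemma frobSq_mul_of_mul_transpose_eq_one {m k l : ℕ} (A : Matrix (Fin m) (Fin k) ℝ)
    {Q : Matrix (Fin k) (Fin l) ℝ} (hQ : Q * Qᵀ = 1) : frobSq (A * Q) = frobSq A := by
  rw [frobSq_eq_trace_mul_transpose, frobSq_eq_trace_mul_transpose, Matrix.transpose_mul,
    Matrix.mul_assoc, ← Matrix.mul_assoc Q, hQ, Matrix.one_mul]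

/-- Projecting onto the orthogonal complement of an orthonormal basis does not increase the
Frobenius norm. -/
lemma frobSq_sub_proj_le {N n w : ℕ} {Q : Matrix (Fin N) (Fin n) ℝ} (hQ : Qᵀ * Q = 1)
    (E : Matrix (Fin N) (Fin w) ℝ) : frobSq (E - Q * Qᵀ * E) ≤ frobSq E := by
  have key : (E - Q * Qᵀ * E)ᵀ * (E - Q * Qᵀ * E) = Eᵀ * E - (Qᵀ * E)ᵀ * (Qᵀ * E) := by
    have h : Eᵀ * Q * Qᵀ * (Q * Qᵀ * E) = Eᵀ * Q * Qᵀ * E := by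
      calc Eᵀ * Q * Qᵀ * (Q * Qᵀ * E) = Eᵀ * Q * (Qᵀ * Q) * Qᵀ * E := by
            simp only [Matrix.mul_assoc]
        _ = _ := by rw [hQ, Matrix.mul_one]
    simp only [Matrix.transpose_sub, Matrix.transpose_mul, Matrix.transpose_transpose,
      Matrix.sub_mul, Matrix.mul_sub, Matrix.mul_assoc] at h ⊢
    rw [h]
    abel
  have h0 := frobSq_nonneg (Qᵀ * E)
  rw [frobSq_eq_trace_transpose_mul, key, Matrix.trace_sub, ← frobSq_eq_trace_transpose_mul,
    ← frobSq_eq_trace_transpose_mul]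
  linarith

/-- Singular value decomposition in matrix form. -/
lemma IsSingularValues.exists_eq_mul {m k r : ℕ} {M : Matrix (Fin m) (Fin k) ℝ} {σ : Fin r → ℝ}
    (h : IsSingularValues M r σ) :
    ∃ (W : Matrix (Fin m) (Fin r) ℝ) (V : Matrix (Fin k) (Fin r) ℝ),
      Wᵀ * W = 1 ∧ Vᵀ * V = 1 ∧ M = W * Matrix.diagonal σ * Vᵀ := by
  obtain ⟨-, -, u, v, hu, hv, hM⟩ := h
  refine ⟨Matrix.of fun i k => u k i, Matrix.of fun i k => v k i, ?_, ?_, ?_⟩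
  · ext i j
    simpa [Matrix.mul_apply, dotProduct, Matrix.one_apply] using hu i j
  · ext i j
    simpa [Matrix.mul_apply, dotProduct, Matrix.one_apply] using hv i j
  · ext i j
    rw [hM, Matrix.mul_apply, Matrix.sum_apply]
    refine Finset.sum_congr rfl fun l _ => ?_
    simp [Matrix.mul_diagonal, Matrix.vecMulVec_apply]
    ring

/-- If `F` has rank `n` and its columns lie in the span of the orthonormal `Ubar`, then a linear
map applied to `F` dominates the same map applied to `Ubar`, up to any lower bound on the
singular values of `F`. -/
lemma sq_mul_frobSq_mul_le {l N n w : ℕ} {Ubar : Matrix (Fin N) (Fin n) ℝ}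
    (hUbar : Ubarᵀ * Ubar = 1) {F : Matrix (Fin N) (Fin w) ℝ}
    (hF : ∃ G : Matrix (Fin n) (Fin w) ℝ, F = Ubar * G) {σ : Fin n → ℝ}
    (hσ : IsSingularValues F n σ) {s : ℝ} (hs : 0 ≤ s) (hsσ : ∀ i, s ≤ σ i)
    (A : Matrix (Fin l) (Fin N) ℝ) :
    s ^ 2 * frobSq (A * Ubar) ≤ frobSq (A * F) := by
  obtain ⟨W, V, hW, hV, hWV⟩ := hσ.exists_eq_mul
  obtain ⟨G, hG⟩ := hF
  set D := Matrix.diagonal σ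
  have hD : D * Matrix.diagonal (fun i => (σ i)⁻¹) = 1 := by
    rw [Matrix.diagonal_mul_diagonal, ← Matrix.diagonal_one]
    congr 1
    ext i
    exact mul_inv_cancel₀ (hσ.1 i).ne'
  set Q := G * V * Matrix.diagonal (fun i => (σ i)⁻¹) with hQdef
  have hWQ : W = Ubar * Q := by
    calc W = W * (D * Matrix.diagonal (fun i => (σ i)⁻¹)) := by rw [hD, Matrix.mul_one]
      _ = W * D * (Vᵀ * V) * Matrix.diagonal (fun i => (σ i)⁻¹) := by
          rw [hV, Matrix.mul_one, Matrix.mul_assoc]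
      _ = F * V * Matrix.diagonal (fun i => (σ i)⁻¹) := by
          rw [hWV]; simp only [Matrix.mul_assoc]
      _ = Ubar * Q := by rw [hG, hQdef]; simp only [Matrix.mul_assoc]
  have hQ : Q * Qᵀ = 1 := by
    rw [mul_eq_one_comm]
    calc Qᵀ * Q = Qᵀ * (Ubarᵀ * Ubar) * Q := by rw [hUbar, Matrix.mul_one]
      _ = Wᵀ * W := by rw [hWQ, Matrix.transpose_mul Ubar]; simp only [Matrix.mul_assoc]
      _ = 1 := hW
  have h1 : frobSq (A * Ubar) = frobSq (A * W) := by
    rw [hWQ, ← Matrix.mul_assoc, frobSq_mul_of_mul_transpose_eq_one _ hQ]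
  have h2 : frobSq (A * F) = frobSq (A * W * D) := by
    rw [frobSq_eq_trace_mul_transpose, frobSq_eq_trace_mul_transpose]
    congr 1
    calc A * F * (A * F)ᵀ = A * W * D * (Vᵀ * V) * (A * W * D)ᵀ := by
          rw [hWV]
          simp only [Matrix.transpose_mul, Matrix.transpose_transpose, Matrix.mul_assoc]
      _ = _ := by rw [hV, Matrix.mul_one]
  rw [h1, h2, frobSq, frobSq, Finset.mul_sum]
  refine Finset.sum_le_sum fun i _ => ?_
  rw [Finset.mul_sum]
  refine Finset.sum_le_sum fun k _ => ?_
  rw [Matrix.mul_diagonal, mul_pow, mul_comm]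
  exact mul_le_mul_of_nonneg_left (pow_le_pow_left₀ hs (hsσ k) 2) (sq_nonneg _)

lemma samplingMatrix_transpose_mul_apply {N m k : ℕ} (s : Fin m → Fin N)
    (A : Matrix (Fin N) (Fin k) ℝ) (i : Fin m) (l : Fin k) :
    ((samplingMatrix s)ᵀ * A) i l = A (s i) l := by
  simp [samplingMatrix, Matrix.mul_apply]

lemma frobSq_eq_sum_rowNormSq {N k : ℕ} (A : Matrix (Fin N) (Fin k) ℝ)
    (j : Equiv.Perm (Fin N)) : frobSq A = ∑ i, rowNormSq A (j i) :=
  (Equiv.sum_comp j (rowNormSq A)).symm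

/-- Tail bound for the superexponentially decaying sequence `exp (-c * i ^ a)`. -/
lemma sum_exp_neg_mul_rpow_le {c a : ℝ} (hc : 0 < c) (ha : 1 ≤ a) (m d : ℕ) :
    ∑ k ∈ Finset.range d, Real.exp (-c * ((m + k + 1 : ℕ) : ℝ) ^ a) ≤
      Real.exp (-c * (m : ℝ) ^ a) / (1 - Real.exp (-c)) := by
  have hr : Real.exp (-c) < 1 := Real.exp_lt_one_iff.2 (by linarith)
  have hterm : ∀ k : ℕ, Real.exp (-c * ((m + k + 1 : ℕ) : ℝ) ^ a) ≤
      Real.exp (-c * (m : ℝ) ^ a) * Real.exp (-c) ^ k := by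
    intro k
    rw [← Real.exp_nat_mul, ← Real.exp_add, Real.exp_le_exp]
    have h1 : (m : ℝ) ^ a + ((k : ℝ) + 1) ^ a ≤ ((m : ℝ) + (k + 1)) ^ a :=
      Real.add_rpow_le_rpow_add (by positivity) (by positivity) ha
    have h2 : (k : ℝ) + 1 ≤ ((k : ℝ) + 1) ^ a :=
      Real.self_le_rpow_of_one_le (by linarith [Nat.cast_nonneg (α := ℝ) k]) ha
    push_cast
    rw [add_assoc (m : ℝ)]
    nlinarith
  calc _ ≤ ∑ k ∈ Finset.range d, Real.exp (-c * (m : ℝ) ^ a) * Real.exp (-c) ^ k :=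
        Finset.sum_le_sum fun k _ => hterm k
    _ = Real.exp (-c * (m : ℝ) ^ a) * ∑ k ∈ Finset.range d, Real.exp (-c) ^ k :=
        (Finset.mul_sum ..).symm
    _ ≤ Real.exp (-c * (m : ℝ) ^ a) * (1 - Real.exp (-c))⁻¹ := by
        gcongr
        rw [← tsum_geometric_of_lt_one (Real.exp_pos _).le hr]
        exact (summable_geometric_of_lt_one (Real.exp_pos _).le hr).sum_le_tsum _
          fun _ _ => by positivity
    _ = _ := (div_eq_mul_inv ..).symm

/-- `x ↦ (-(1 / c) * log x) ^ (1 / a)` inverts `y ↦ exp (-c * y ^ a)`. -/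
lemma exp_neg_mul_rpow_le {c a x y : ℝ} (hc : 0 < c) (ha : 0 < a) (hx : 0 < x) (hy : 0 ≤ y)
    (h : (-(1 / c) * Real.log x) ^ (1 / a) ≤ y) : Real.exp (-c * y ^ a) ≤ x := by
  have hya : 0 ≤ y ^ a := Real.rpow_nonneg hy a
  rw [← Real.le_log_iff_exp_le hx]
  have key : -(1 / c) * Real.log x ≤ y ^ a := by
    rcases le_total 0 (-(1 / c) * Real.log x) with hb | hb
    · have := Real.rpow_le_rpow (Real.rpow_nonneg hb _) h ha.le
      rwa [← Real.rpow_mul hb, one_div_mul_cancel ha.ne', Real.rpow_one] at this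
    · exact hb.trans hya
  have h2 := mul_le_mul_of_nonneg_left key hc.le
  have h3 : c * (-(1 / c) * Real.log x) = -Real.log x := by field_simp
  linarith

/-- If `E` vanishes on the first `m` rows (in the order `j`) and agrees with `R` on the remaining
ones, its Frobenius norm is bounded by the tail of the residual decay. -/
lemma frobSq_le_of_decay {N w m : ℕ} (hm : m ≤ N) {E R : Matrix (Fin N) (Fin w) ℝ}
    (j : Equiv.Perm (Fin N)) {c₁ c₂ a : ℝ}
    (hdecay : ∀ i : Fin N,
      rowNormSq R (j i) ≤ c₁ * Real.exp (-c₂ * (((i : ℕ) + 1 : ℕ) : ℝ) ^ a))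
    (hlt : ∀ i : Fin N, (i : ℕ) < m → ∀ l, E (j i) l = 0)
    (hge : ∀ i : Fin N, m ≤ (i : ℕ) → ∀ l, E (j i) l = R (j i) l) :
    frobSq E ≤ c₁ * ∑ k ∈ Finset.range (N - m),
      Real.exp (-c₂ * ((m + k + 1 : ℕ) : ℝ) ^ a) := by
  obtain ⟨d, rfl⟩ := Nat.exists_eq_add_of_le hm
  rw [frobSq_eq_sum_rowNormSq E j, Fin.sum_univ_add, Nat.add_sub_cancel_left, Finset.mul_sum,
    ← Fin.sum_univ_eq_sum_range
      (fun k => c₁ * Real.exp (-c₂ * ((m + k + 1 : ℕ) : ℝ) ^ a))]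
  have h0 : ∑ i : Fin m, rowNormSq E (j (Fin.castAdd d i)) = 0 :=
    Finset.sum_eq_zero fun i _ => by simp [rowNormSq, hlt (Fin.castAdd d i) (by simp)]
  rw [h0, zero_add]
  refine Finset.sum_le_sum fun k _ => ?_
  have h := hdecay (Fin.natAdd m k)
  simp only [rowNormSq, hge (Fin.natAdd m k) (by simp)] at h ⊢
  simpa using h

/-- (Proposition 3.3, number of sampling points.)  Under the adaptive-sampling
hypotheses, with `c₃ = c₁ / ((1 − exp(−c₂))·σ_min(F)²)`: for every `ε > 0`, if the number
of sampling points satisfies `m ≥ min{N, (−(1/c₂)·log(ε/c₃))^{1/a}}`, then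
`‖Ubar − Uhat Uhatᵀ Ubar‖_F² ≤ ε`. -/
theorem adaptive_sampling_number_of_samples
    {N n w m : ℕ} (hn : 0 < n) (hm : m ≤ N)
    (Ubar : Matrix (Fin N) (Fin n) ℝ) (hUbar : Ubarᵀ * Ubar = 1)
    (F : Matrix (Fin N) (Fin w) ℝ)
    (hFspan : ∃ G : Matrix (Fin n) (Fin w) ℝ, F = Ubar * G)
    (σF : Fin n → ℝ) (hσF : IsSingularValues F n σF)
    (U : Matrix (Fin N) (Fin n) ℝ)
    (p : Fin n → Fin N) (hp : Function.Injective p)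
    (hPU : IsUnit ((samplingMatrix p)ᵀ * U))
    (hPF : ((samplingMatrix p)ᵀ * F).rank = n)
    (C : Matrix (Fin n) (Fin w) ℝ)
    (hC : C = ((samplingMatrix p)ᵀ * U)⁻¹ * ((samplingMatrix p)ᵀ * F))
    (R : Matrix (Fin N) (Fin w) ℝ) (hR : R = U * C - F)
    (j : Equiv.Perm (Fin N)) (c₁ c₂ a : ℝ)
    (hc₁ : 0 < c₁) (hc₂ : 0 < c₂) (ha : 1 < a)
    (hdecay : ∀ i : Fin N,
      rowNormSq R (j i) ≤ c₁ * Real.exp (-c₂ * (((i : ℕ) + 1 : ℕ) : ℝ) ^ a))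
    (ΔU : Matrix (Fin N) (Fin n) ℝ)
    (h1 : (samplingMatrix fun k : Fin (N - m) =>
        j ⟨m + (k : ℕ), by have := k.isLt; omega⟩)ᵀ * ΔU = 0)
    (h2 : (samplingMatrix fun k : Fin m => j (Fin.castLE hm k))ᵀ *
        ((U + ΔU) * C - F) = 0)
    (Uhat : Matrix (Fin N) (Fin n) ℝ) (hUhat : Uhatᵀ * Uhat = 1)
    (hspan : ∃ G : Matrix (Fin n) (Fin n) ℝ, IsUnit G ∧ U + ΔU = Uhat * G)
    (ε : ℝ) (hε : 0 < ε)
    (hmε : min (N : ℝ)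
        ((-(1 / c₂) * Real.log (ε /
          (c₁ / ((1 - Real.exp (-c₂)) * σF ⟨n - 1, Nat.sub_lt hn one_pos⟩ ^ 2)))) ^
            (1 / a)) ≤ (m : ℝ)) :
    frobSq (Ubar - Uhat * Uhatᵀ * Ubar) ≤ ε := by
  set s := σF ⟨n - 1, Nat.sub_lt hn one_pos⟩
  have hs : 0 < s := hσF.1 _
  have hr : 0 < 1 - Real.exp (-c₂) := sub_pos.2 (Real.exp_lt_one_iff.2 (by linarith))
  set E := (U + ΔU) * C - F with hE
  have hElt : ∀ i : Fin N, (i : ℕ) < m → ∀ l, E (j i) l = 0 := fun i hi l => by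
    have h := congrFun (congrFun h2 ⟨i, hi⟩) l
    rwa [samplingMatrix_transpose_mul_apply] at h
  have hEge : ∀ i : Fin N, m ≤ (i : ℕ) → ∀ l, E (j i) l = R (j i) l := fun i hi l => by
    have hΔ : ∀ q, ΔU (j i) q = 0 := fun q => by
      have h := congrFun (congrFun h1 ⟨i - m, by have := i.isLt; omega⟩) q
      rw [samplingMatrix_transpose_mul_apply] at h
      simpa [Nat.add_sub_cancel' hi] using h
    simp [hE, hR, Matrix.mul_apply, hΔ]
  have hEbound := frobSq_le_of_decay hm j hdecay hElt hEge
  have hproj : frobSq (F - Uhat * Uhatᵀ * F) ≤ frobSq E := by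
    obtain ⟨G, -, hG⟩ := hspan
    have hUG : Uhat * Uhatᵀ * (Uhat * G * C) = Uhat * G * C := by
      calc Uhat * Uhatᵀ * (Uhat * G * C) = Uhat * (Uhatᵀ * Uhat) * G * C := by
            simp only [Matrix.mul_assoc]
        _ = _ := by rw [hUhat, Matrix.mul_one]
    have hFE : F - Uhat * Uhatᵀ * F = -(E - Uhat * Uhatᵀ * E) := by
      rw [hE, hG, Matrix.mul_sub, hUG]
      abel
    have hneg : frobSq (-(E - Uhat * Uhatᵀ * E)) = frobSq (E - Uhat * Uhatᵀ * E) := by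
      simp only [frobSq, Matrix.neg_apply, neg_sq]
    rw [hFE, hneg]
    exact frobSq_sub_proj_le hUhat E
  have hσ : s ^ 2 * frobSq (Ubar - Uhat * Uhatᵀ * Ubar) ≤ frobSq (F - Uhat * Uhatᵀ * F) := by
    have h := sq_mul_frobSq_mul_le hUbar hFspan hσF hs.le
      (fun i => hσF.2.1 (Fin.le_def.2 (by simp only; omega))) (1 - Uhat * Uhatᵀ)
    simpa only [Matrix.sub_mul, Matrix.one_mul] using h
  rcases min_le_iff.1 hmε with h | h
  · have hNm : N - m = 0 := Nat.sub_eq_zero_of_le (by exact_mod_cast h)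
    rw [hNm, Finset.range_zero, Finset.sum_empty, mul_zero] at hEbound
    have hs2 : 0 < s ^ 2 := by positivity
    have : frobSq (Ubar - Uhat * Uhatᵀ * Ubar) ≤ 0 := by
      by_contra! hpos
      linarith [mul_pos hs2 hpos]
    linarith
  · have hc₃ : 0 < c₁ / ((1 - Real.exp (-c₂)) * s ^ 2) := by positivity
    have hexp := exp_neg_mul_rpow_le hc₂ (by linarith) (div_pos hε hc₃) (Nat.cast_nonneg m) h
    have htail := mul_le_mul_of_nonneg_left
      (sum_exp_neg_mul_rpow_le hc₂ ha.le m (N - m)) hc₁.le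
    calc frobSq (Ubar - Uhat * Uhatᵀ * Ubar)
        ≤ c₁ * (Real.exp (-c₂ * (m : ℝ) ^ a) / (1 - Real.exp (-c₂))) / s ^ 2 := by
          rw [le_div_iff₀ (by positivity), mul_comm]
          linarith
      _ = Real.exp (-c₂ * (m : ℝ) ^ a) * (c₁ / ((1 - Real.exp (-c₂)) * s ^ 2)) := by
          field_simp
      _ ≤ ε := (le_div_iff₀ hc₃).1 hexp
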